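/- arXiv:1910.03395 — 6 statements merged into one kernel-verified Lean document; each statement's English description precedes it below -/
import Mathlib

section
/- Let L be a lattice with no doubly reducible elements, and let a₁, a₂, a₃, b₁, b₂, b₃ be six distinct elements of L such that a₁ < a₂ < a₃, b₁ < b₂ < b₃, a₁ < b₃, b₁ < a₃, a₂ ∥ bᵢ for i = 1,2,3, aᵢ ∥ b₂ for i = 1,2,3, a₂ ⊔ b₂ = a₃ ⊔ b₃, and a₂ ⊓ b₂ = a₁ ⊓ b₁. Then L contains a sublattice isomorphic to L₁₅; explicitly, there exist ten pairwise distinct elements o, q₁, q₂, p, m, r₁, r₂, t, s₁, s₂ of L satisfying q₁ ⊓ q₂ = o, q₁ ⊔ q₂ = p, r₁ ⊓ r₂ = m, r₁ ⊔ r₂ = t, s₁ ⊓ s₂ = o, s₁ ⊔ s₂ = t, s₁ ⊓ m = q₁, s₁ ⊔ p = r₁, s₂ ⊓ m = q₂, s₂ ⊔ p = r₂, s₁ ⊔ q₂ = r₁, s₂ ⊔ q₁ = r₂, s₁ ⊓ r₂ = q₁, and s₂ ⊓ r₁ = q₂ (so these ten elements are closed under ⊔ and ⊓ and form a copy of L₁₅).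 -/
def Incomp {L : Type*} [Lattice L] (a b : L) : Prop := ¬ a ≤ b ∧ ¬ b ≤ a

def Semidistrib (L : Type*) [Lattice L] : Prop :=
  (∀ a b c : L, a ⊔ b = a ⊔ c → a ⊔ (b ⊓ c) = a ⊔ b) ∧
  (∀ a b c : L, a ⊓ b = a ⊓ c → a ⊓ (b ⊔ c) = a ⊓ b)

def Whitman (L : Type*) [Lattice L] : Prop :=
  ∀ a b c d : L, a ⊓ b ≤ c ⊔ d → a ≤ c ⊔ d ∨ b ≤ c ⊔ d ∨ a ⊓ b ≤ c ∨ a ⊓ b ≤ d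

def DoublyReducible {L : Type*} [Lattice L] (x : L) : Prop :=
  ∃ a₁ a₂ a₃ a₄ : L, Incomp a₁ a₂ ∧ Incomp a₃ a₄ ∧ x = a₁ ⊔ a₂ ∧ x = a₃ ⊓ a₄

/-- `L` contains a sublattice isomorphic to `K`: an injective map preserving `⊔` and `⊓`. -/
def ContainsCopyOf (K L : Type*) [Lattice K] [Lattice L] : Prop :=
  ∃ f : K → L, Function.Injective f ∧ (∀ x y : K, f (x ⊔ y) = f x ⊔ f y) ∧
    (∀ x y : K, f (x ⊓ y) = f x ⊓ f y)

theorem pentagon_variety_L15_lemma {L : Type*} [Lattice L]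
    (hndr : ∀ x : L, ¬ DoublyReducible x)
    (a₁ a₂ a₃ b₁ b₂ b₃ : L)
    (hdist : List.Pairwise (· ≠ ·) [a₁, a₂, a₃, b₁, b₂, b₃])
    (ha12 : a₁ < a₂) (ha23 : a₂ < a₃) (hb12 : b₁ < b₂) (hb23 : b₂ < b₃)
    (hab : a₁ < b₃) (hba : b₁ < a₃)
    (hpar1 : Incomp a₂ b₁) (hpar2 : Incomp a₂ b₂) (hpar3 : Incomp a₂ b₃)
    (hpar4 : Incomp a₁ b₂) (hpar5 : Incomp a₃ b₂)
    (hsup : a₂ ⊔ b₂ = a₃ ⊔ b₃) (hinf : a₂ ⊓ b₂ = a₁ ⊓ b₁) :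
    ∃ o q₁ q₂ p m r₁ r₂ t s₁ s₂ : L,
      List.Pairwise (· ≠ ·) [o, q₁, q₂, p, m, r₁, r₂, t, s₁, s₂] ∧
      q₁ ⊓ q₂ = o ∧ q₁ ⊔ q₂ = p ∧ r₁ ⊓ r₂ = m ∧ r₁ ⊔ r₂ = t ∧
      s₁ ⊓ s₂ = o ∧ s₁ ⊔ s₂ = t ∧
      s₁ ⊓ m = q₁ ∧ s₁ ⊔ p = r₁ ∧ s₂ ⊓ m = q₂ ∧ s₂ ⊔ p = r₂ ∧
      s₁ ⊔ q₂ = r₁ ∧ s₂ ⊔ q₁ = r₂ ∧ s₁ ⊓ r₂ = q₁ ∧ s₂ ⊓ r₁ = q₂ := by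
  have ha₁ : a₁ ≤ a₂ ⊓ b₃ := le_inf ha12.le hab.le
  have hb₁ : b₁ ≤ b₂ ⊓ a₃ := le_inf hb12.le hba.le
  obtain ⟨q₁, hq₁⟩ : ∃ q₁, q₁ = a₂ ⊓ b₃ := ⟨_, rfl⟩
  obtain ⟨q₂, hq₂⟩ : ∃ q₂, q₂ = b₂ ⊓ a₃ := ⟨_, rfl⟩
  obtain ⟨r₁, hr₁⟩ : ∃ r₁, r₁ = a₂ ⊔ q₂ := ⟨_, rfl⟩
  obtain ⟨r₂, hr₂⟩ : ∃ r₂, r₂ = b₂ ⊔ q₁ := ⟨_, rfl⟩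
  rw [← hq₁] at ha₁
  rw [← hq₂] at hb₁
  have hq₁a : q₁ ≤ a₂ := hq₁ ▸ inf_le_left
  have hq₁b : q₁ ≤ b₃ := hq₁ ▸ inf_le_right
  have hq₂b : q₂ ≤ b₂ := hq₂ ▸ inf_le_left
  have hq₂a : q₂ ≤ a₃ := hq₂ ▸ inf_le_right
  have har : a₂ ≤ r₁ := hr₁ ▸ le_sup_left
  have hqr : q₂ ≤ r₁ := hr₁ ▸ le_sup_right
  have hbr : b₂ ≤ r₂ := hr₂ ▸ le_sup_left
  have hqr' : q₁ ≤ r₂ := hr₂ ▸ le_sup_right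
  have hr₁a : r₁ ≤ a₃ := hr₁ ▸ sup_le ha23.le hq₂a
  have hr₂b : r₂ ≤ b₃ := hr₂ ▸ sup_le hb23.le hq₁b
  have hq : Incomp q₁ q₂ :=
    ⟨fun h => hpar4.1 (ha₁.trans (h.trans hq₂b)), fun h => hpar1.2 (hb₁.trans (h.trans hq₁a))⟩
  have hr : Incomp r₁ r₂ :=
    ⟨fun h => hpar3.1 (har.trans (h.trans hr₂b)), fun h => hpar5.2 (hbr.trans (h.trans hr₁a))⟩
  have hpm : q₁ ⊔ q₂ ≤ r₁ ⊓ r₂ :=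
    sup_le (le_inf (hq₁a.trans har) hqr') (le_inf hqr (hq₂b.trans hbr))
  have hne : q₁ ⊔ q₂ ≠ r₁ ⊓ r₂ := fun h => hndr _ ⟨q₁, q₂, r₁, r₂, hq, hr, rfl, h⟩
  have ho : q₁ ⊓ q₂ = a₂ ⊓ b₂ := by
    refine le_antisymm (inf_le_inf hq₁a hq₂b) ?_
    rw [hinf]
    exact inf_le_inf ha₁ hb₁
  have ht : r₁ ⊔ r₂ = a₂ ⊔ b₂ := by
    refine le_antisymm ?_ (sup_le_sup har hbr)
    rw [hsup]
    exact sup_le_sup hr₁a hr₂b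
  have hs₁ : a₂ ⊓ r₂ = q₁ :=
    le_antisymm (hq₁ ▸ inf_le_inf_left _ hr₂b) (le_inf hq₁a hqr')
  have hs₂ : b₂ ⊓ r₁ = q₂ :=
    le_antisymm (hq₂ ▸ inf_le_inf_left _ hr₁a) (le_inf hq₂b hqr)
  refine ⟨a₂ ⊓ b₂, q₁, q₂, q₁ ⊔ q₂, r₁ ⊓ r₂, r₁, r₂, a₂ ⊔ b₂, a₂, b₂, ?_, ho, rfl, rfl, ht, rfl,
    rfl, ?_, ?_, ?_, ?_, hr₁.symm, hr₂.symm, hs₁, hs₂⟩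
  · obtain ⟨o, ho'⟩ : ∃ o, o = a₂ ⊓ b₂ := ⟨_, rfl⟩
    obtain ⟨t, ht'⟩ : ∃ t, t = a₂ ⊔ b₂ := ⟨_, rfl⟩
    obtain ⟨p, hp⟩ : ∃ p, p = q₁ ⊔ q₂ := ⟨_, rfl⟩
    obtain ⟨m, hm⟩ : ∃ m, m = r₁ ⊓ r₂ := ⟨_, rfl⟩
    have hoq₁ : o ≤ q₁ := ho' ▸ ho ▸ inf_le_left
    have hoq₂ : o ≤ q₂ := ho' ▸ ho ▸ inf_le_right
    have hq₁p : q₁ ≤ p := hp ▸ le_sup_left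
    have hq₂p : q₂ ≤ p := hp ▸ le_sup_right
    have hmr₁ : m ≤ r₁ := hm ▸ inf_le_left
    have hmr₂ : m ≤ r₂ := hm ▸ inf_le_right
    have hr₁t : r₁ ≤ t := ht' ▸ ht ▸ le_sup_left
    have hr₂t : r₂ ≤ t := ht' ▸ ht ▸ le_sup_right
    obtain ⟨_, _⟩ := hq
    obtain ⟨_, _⟩ := hr
    obtain ⟨_, _⟩ := hpar1
    obtain ⟨_, _⟩ := hpar2
    obtain ⟨_, _⟩ := hpar3
    obtain ⟨_, _⟩ := hpar4
    obtain ⟨_, _⟩ := hpar5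
    rw [← ho', ← ht', ← hp, ← hm]
    rw [← hp, ← hm] at hpm hne
    clear hsup hinf hdist ho ht hs₁ hs₂ ho' ht' hp hm hq₁ hq₂ hr₁ hr₂ hndr
    simp only [List.pairwise_cons, List.mem_cons, List.not_mem_nil, or_false, forall_eq_or_imp,
      forall_eq, IsEmpty.forall_iff, implies_true, List.Pairwise.nil, and_true]
    repeat' apply And.intro
    all_goals order
  · exact le_antisymm (hs₁ ▸ inf_le_inf_left _ inf_le_right)
      (le_inf hq₁a (le_sup_left.trans hpm))
  · rw [hr₁, ← sup_assoc, sup_eq_left.2 hq₁a]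
  · exact le_antisymm (hs₂ ▸ inf_le_inf_left _ inf_le_left)
      (le_inf hq₂b (le_sup_right.trans hpm))
  · rw [hr₂, sup_comm q₁, ← sup_assoc, sup_eq_left.2 hq₂b]
end

section
/- Let L be a semidistributive lattice and let a, b, c be three pairwise incomparable elements of L with a ⊓ b = b ⊓ c = c ⊓ a. Then the three joins a ⊔ b, b ⊔ c, c ⊔ a are pairwise incomparable; in particular they are pairwise distinct. -/
theorem Semidistrib.le_of_le_sup_of_inf_eq {L : Type*} [Lattice L] (hsd : Semidistrib L)
    {x y z : L} (h : x ⊓ y = x ⊓ z) (hx : x ≤ y ⊔ z) : x ≤ y := by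
  have key := hsd.2 x y z h
  rw [inf_eq_left.mpr hx] at key
  exact inf_eq_left.mp key.symm

theorem joins_pairwise_incomparable {L : Type*} [Lattice L]
    (hsd : Semidistrib L) (a b c : L)
    (hab : Incomp a b) (hbc : Incomp b c) (hca : Incomp c a)
    (h1 : a ⊓ b = b ⊓ c) (h2 : b ⊓ c = c ⊓ a) :
    (Incomp (a ⊔ b) (b ⊔ c) ∧ Incomp (b ⊔ c) (c ⊔ a) ∧ Incomp (c ⊔ a) (a ⊔ b)) ∧
    (a ⊔ b ≠ b ⊔ c ∧ b ⊔ c ≠ c ⊔ a ∧ c ⊔ a ≠ a ⊔ b) := by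
  have ha : ¬ a ≤ b ⊔ c := fun h =>
    hab.1 (hsd.le_of_le_sup_of_inf_eq ((h1.trans h2).trans (inf_comm c a)) h)
  have hb : ¬ b ≤ c ⊔ a := fun h =>
    hbc.1 (hsd.le_of_le_sup_of_inf_eq (h1.symm.trans (inf_comm a b)) h)
  have hc : ¬ c ≤ a ⊔ b := fun h =>
    hca.1 (hsd.le_of_le_sup_of_inf_eq (h2.symm.trans (inf_comm b c)) h)
  have hab_bc : Incomp (a ⊔ b) (b ⊔ c) :=
    ⟨fun h => ha (le_sup_left.trans h), fun h => hc (le_sup_right.trans h)⟩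
  have hbc_ca : Incomp (b ⊔ c) (c ⊔ a) :=
    ⟨fun h => hb (le_sup_left.trans h), fun h => ha (le_sup_right.trans h)⟩
  have hca_ab : Incomp (c ⊔ a) (a ⊔ b) :=
    ⟨fun h => hc (le_sup_left.trans h), fun h => hb (le_sup_right.trans h)⟩
  exact ⟨⟨hab_bc, hbc_ca, hca_ab⟩,
    fun h => hab_bc.1 h.le, fun h => hbc_ca.1 h.le, fun h => hca_ab.1 h.le⟩
end

section
/- Let L be a semidistributive lattice and let a, b, c be three pairwise incomparable elements of L with a ⊓ b = b ⊓ c = c ⊓ a = d. Set a* = (a ⊔ b) ⊓ (c ⊔ a), b* = (a ⊔ b) ⊓ (b ⊔ c), and c* = (c ⊔ a) ⊓ (b ⊔ c). Then a* ⊔ b* = a ⊔ b, b* ⊔ c* = b ⊔ c, c* ⊔ a* = c ⊔ a, a* ⊓ b* = b* ⊓ c* = c* ⊓ a* = d, a* ⊓ (b ⊔ c) = b* ⊓ (c ⊔ a) = c* ⊓ (a ⊔ b) = d, and a* ⊔ b* ⊔ c* = a ⊔ b ⊔ c. Consequently the eight elements d, a*, b*, c*, a ⊔ b, b ⊔ c,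 c ⊔ a, a ⊔ b ⊔ c are pairwise distinct and form a sublattice of L isomorphic to the Boolean lattice 2³. -/
theorem range_fin_three_bool {α : Type*} (f : (Fin 3 → Bool) → α) :
    Set.range f = {f ![false, false, false], f ![true, false, false], f ![false, true, false],
      f ![false, false, true], f ![true, true, false], f ![false, true, true],
      f ![true, false, true], f ![true, true, true]} := by
  have h : (Set.univ : Set (Fin 3 → Bool)) = {![false, false, false], ![true, false, false],
      ![false, true, false], ![false, false, true], ![true, true, false], ![false, true, true],
      ![true, false, true], ![true, true, true]} := by
    ext x
    simp only [Set.mem_univ, Set.mem_insert_iff, Set.mem_singleton_iff, true_iff]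
    revert x
    decide
  rw [← Set.image_univ, h]
  simp only [Set.image_insert_eq, Set.image_singleton]

section Cube

variable {L : Type*} [Lattice L]

/-- The join of the selected elements among `p`, `q`, `r`, over the base element `d`. -/
def cubeJoin (d p q r : L) (x : Fin 3 → Bool) : L :=
  cond (x 0) p d ⊔ cond (x 1) q d ⊔ cond (x 2) r d

theorem cubeJoin_sup {d p q r : L} (hp : d ≤ p) (hq : d ≤ q) (hr : d ≤ r) (x y : Fin 3 → Bool) :
    cubeJoin d p q r (x ⊔ y) = cubeJoin d p q r x ⊔ cubeJoin d p q r y := by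
  have key : ∀ (s s' : Bool) {e : L}, d ≤ e → cond (s ⊔ s') e d = cond s e d ⊔ cond s' e d := by
    intro s s' e h
    cases s <;> cases s' <;> simp [h]
  simp only [cubeJoin, Pi.sup_apply, key _ _ hp, key _ _ hq, key _ _ hr]
  ac_rfl

/-- The meet of the unselected elements among `u`, `v`, `w`, under the top element `t`. -/
def cubeMeet (t u v w : L) (x : Fin 3 → Bool) : L :=
  cond (x 0) t u ⊓ cond (x 1) t v ⊓ cond (x 2) t w

theorem cubeMeet_inf {t u v w : L} (hu : u ≤ t) (hv : v ≤ t) (hw : w ≤ t) (x y : Fin 3 → Bool) :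
    cubeMeet t u v w (x ⊓ y) = cubeMeet t u v w x ⊓ cubeMeet t u v w y := by
  have key : ∀ (s s' : Bool) {e : L}, e ≤ t → cond (s ⊓ s') t e = cond s t e ⊓ cond s' t e := by
    intro s s' e h
    cases s <;> cases s' <;> simp [h]
  simp only [cubeMeet, Pi.inf_apply, key _ _ hu, key _ _ hv, key _ _ hw]
  ac_rfl

theorem Semidistrib.not_le_sup (hsd : Semidistrib L) {a b c : L} (hab : ¬ a ≤ b)
    (h : a ⊓ b = a ⊓ c) : ¬ a ≤ b ⊔ c := fun hle =>
  hab (inf_eq_left.1 ((hsd.2 a b c h).symm.trans (inf_eq_left.2 hle)))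

theorem Semidistrib.inf_sups_eq (hsd : Semidistrib L) {a b c d : L}
    (h1 : a ⊓ b = d) (h2 : b ⊓ c = d) (h3 : c ⊓ a = d) :
    (a ⊔ b) ⊓ (c ⊔ a) ⊓ (b ⊔ c) = d := by
  have ha : a ⊓ (b ⊔ c) = d := by rw [hsd.2 a b c (by rw [h1, inf_comm, h3]), h1]
  have hb : b ⊓ (c ⊔ a) = d := by rw [hsd.2 b c a (by rw [h2, inf_comm, h1]), h2]
  set m := (a ⊔ b) ⊓ (c ⊔ a) ⊓ (b ⊔ c) with hm
  have hma : m ⊓ a = d := by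
    rw [← ha]
    apply le_antisymm
    · exact le_inf inf_le_right (inf_le_left.trans inf_le_right)
    · exact le_inf (le_inf (le_inf (inf_le_left.trans le_sup_left) (inf_le_left.trans le_sup_right))
        inf_le_right) inf_le_left
  have hmb : m ⊓ b = d := by
    rw [← hb]
    apply le_antisymm
    · exact le_inf inf_le_right (inf_le_left.trans (inf_le_left.trans inf_le_right))
    · exact le_inf (le_inf (le_inf (inf_le_left.trans le_sup_right) inf_le_right)
        (inf_le_left.trans le_sup_left)) inf_le_left
  rw [← hma, ← hsd.2 m a b (hma.trans hmb.symm)]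
  exact (inf_eq_left.2 (inf_le_left.trans inf_le_left)).symm

end Cube

theorem boolean_cube_from_antichain {L : Type*} [Lattice L]
    (hsd : Semidistrib L) (a b c d : L)
    (hab : Incomp a b) (hbc : Incomp b c) (hca : Incomp c a)
    (h1 : a ⊓ b = d) (h2 : b ⊓ c = d) (h3 : c ⊓ a = d) :
    ((a ⊔ b) ⊓ (c ⊔ a)) ⊔ ((a ⊔ b) ⊓ (b ⊔ c)) = a ⊔ b ∧
    ((a ⊔ b) ⊓ (b ⊔ c)) ⊔ ((c ⊔ a) ⊓ (b ⊔ c)) = b ⊔ c ∧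
    ((c ⊔ a) ⊓ (b ⊔ c)) ⊔ ((a ⊔ b) ⊓ (c ⊔ a)) = c ⊔ a ∧
    ((a ⊔ b) ⊓ (c ⊔ a)) ⊓ ((a ⊔ b) ⊓ (b ⊔ c)) = d ∧
    ((a ⊔ b) ⊓ (b ⊔ c)) ⊓ ((c ⊔ a) ⊓ (b ⊔ c)) = d ∧
    ((c ⊔ a) ⊓ (b ⊔ c)) ⊓ ((a ⊔ b) ⊓ (c ⊔ a)) = d ∧
    ((a ⊔ b) ⊓ (c ⊔ a)) ⊓ (b ⊔ c) = d ∧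
    ((a ⊔ b) ⊓ (b ⊔ c)) ⊓ (c ⊔ a) = d ∧
    ((c ⊔ a) ⊓ (b ⊔ c)) ⊓ (a ⊔ b) = d ∧
    ((a ⊔ b) ⊓ (c ⊔ a)) ⊔ ((a ⊔ b) ⊓ (b ⊔ c)) ⊔ ((c ⊔ a) ⊓ (b ⊔ c)) = a ⊔ b ⊔ c ∧
    List.Pairwise (· ≠ ·) [d, (a ⊔ b) ⊓ (c ⊔ a), (a ⊔ b) ⊓ (b ⊔ c), (c ⊔ a) ⊓ (b ⊔ c),
      a ⊔ b, b ⊔ c, c ⊔ a, a ⊔ b ⊔ c] ∧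
    ∃ f : (Fin 3 → Bool) → L, Function.Injective f ∧
      (∀ x y, f (x ⊔ y) = f x ⊔ f y) ∧ (∀ x y, f (x ⊓ y) = f x ⊓ f y) ∧
      Set.range f = {d, (a ⊔ b) ⊓ (c ⊔ a), (a ⊔ b) ⊓ (b ⊔ c), (c ⊔ a) ⊓ (b ⊔ c),
        a ⊔ b, b ⊔ c, c ⊔ a, a ⊔ b ⊔ c} := by
  have hna : ¬ a ≤ b ⊔ c := hsd.not_le_sup hab.1 (by rw [h1, inf_comm, h3])
  have hnb : ¬ b ≤ c ⊔ a := hsd.not_le_sup hbc.1 (by rw [h2, inf_comm, h1])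
  have hnc : ¬ c ≤ a ⊔ b := hsd.not_le_sup hca.1 (by rw [h3, inf_comm, h2])
  have hm := hsd.inf_sups_eq h1 h2 h3
  have hda : d ≤ a := h1 ▸ inf_le_left
  have hdb : d ≤ b := h1 ▸ inf_le_right
  have hdc : d ≤ c := h2 ▸ inf_le_right
  obtain ⟨u, hu⟩ : ∃ u, u = b ⊔ c := ⟨_, rfl⟩
  obtain ⟨v, hv⟩ : ∃ v, v = c ⊔ a := ⟨_, rfl⟩
  obtain ⟨w, hw⟩ : ∃ w, w = a ⊔ b := ⟨_, rfl⟩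
  obtain ⟨t, ht⟩ : ∃ t, t = a ⊔ b ⊔ c := ⟨_, rfl⟩
  rw [← ht, ← hu, ← hv, ← hw]
  rw [← hu, ← hv, ← hw] at hm
  rw [← hu] at hna
  rw [← hv] at hnb
  rw [← hw] at hnc
  have hbu : b ≤ u := hu ▸ le_sup_left
  have hcu : c ≤ u := hu ▸ le_sup_right
  have hcv : c ≤ v := hv ▸ le_sup_left
  have hav : a ≤ v := hv ▸ le_sup_right
  have haw : a ≤ w := hw ▸ le_sup_left
  have hbw : b ≤ w := hw ▸ le_sup_right
  have hut : u ≤ t := hu ▸ ht ▸ sup_le (le_sup_right.trans le_sup_left) le_sup_right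
  have hvt : v ≤ t := hv ▸ ht ▸ sup_le le_sup_right (le_sup_left.trans le_sup_left)
  have hwt : w ≤ t := hw ▸ ht ▸ le_sup_left
  have hap : a ≤ w ⊓ v := le_inf haw hav
  have hbq : b ≤ w ⊓ u := le_inf hbw hbu
  have hcr : c ≤ v ⊓ u := le_inf hcv hcu
  have hpq : (w ⊓ v) ⊔ (w ⊓ u) = w :=
    le_antisymm (sup_le inf_le_left inf_le_left) (hw.le.trans (sup_le_sup hap hbq))
  have hqr : (w ⊓ u) ⊔ (v ⊓ u) = u :=
    le_antisymm (sup_le inf_le_right inf_le_right) (hu.le.trans (sup_le_sup hbq hcr))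
  have hrp : (v ⊓ u) ⊔ (w ⊓ v) = v :=
    le_antisymm (sup_le inf_le_left inf_le_right) (hv.le.trans (sup_le_sup hcr hap))
  have hpqr : (w ⊓ v) ⊔ (w ⊓ u) ⊔ (v ⊓ u) = t := by
    rw [hpq]
    exact le_antisymm (sup_le hwt (inf_le_left.trans hvt))
      (ht.le.trans (hw ▸ sup_le_sup_left hcr _))
  have hdp := hda.trans hap
  have hdq := hdb.trans hbq
  have hdr := hdc.trans hcr
  have hdw := hdp.trans inf_le_left
  have hprv : (w ⊓ v) ⊔ (v ⊓ u) = v := by rw [sup_comm, hrp]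
  have hwr : w ⊔ (v ⊓ u) = t := by rw [← hpq, hpqr]
  have hjm : ∀ x, cubeJoin d (w ⊓ v) (w ⊓ u) (v ⊓ u) x = cubeMeet t u v w x := by
    intro x
    have hm' : v ⊓ u ⊓ w = d := by rw [← hm]; ac_rfl
    unfold cubeJoin cubeMeet
    cases x 0 <;> cases x 1 <;> cases x 2 <;>
      simp only [cond_true, cond_false, sup_idem, inf_idem, sup_eq_left.2 hdp,
        sup_eq_right.2 hdq, sup_eq_right.2 hdr, sup_eq_left.2 hdw, hpq, hqr, hprv, hwr,
        sup_eq_left.2 hdq, hm', inf_eq_left.2 hut, inf_eq_left.2 hvt, inf_eq_right.2 hvt,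
        inf_eq_right.2 hwt, inf_eq_left.2 (inf_le_left.trans hvt : v ⊓ u ≤ t), inf_comm u v,
        inf_comm u w, inf_comm v w]
  have hinj : Function.Injective (cubeJoin d (w ⊓ v) (w ⊓ u) (v ⊓ u)) := by
    have e0 : ∀ x, a ≤ cubeJoin d (w ⊓ v) (w ⊓ u) (v ⊓ u) x ↔ x 0 = true := by
      refine fun x => ⟨fun h => ?_, fun h => ?_⟩
      · by_contra hx
        rw [hjm, cubeMeet, eq_false_of_ne_true hx] at h
        exact hna (h.trans (inf_le_left.trans inf_le_left))
      · rw [cubeJoin, h]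
        exact hap.trans (le_sup_left.trans le_sup_left)
    have e1 : ∀ x, b ≤ cubeJoin d (w ⊓ v) (w ⊓ u) (v ⊓ u) x ↔ x 1 = true := by
      refine fun x => ⟨fun h => ?_, fun h => ?_⟩
      · by_contra hx
        rw [hjm, cubeMeet, eq_false_of_ne_true hx] at h
        exact hnb (h.trans (inf_le_left.trans inf_le_right))
      · rw [cubeJoin, h]
        exact hbq.trans (le_sup_right.trans le_sup_left)
    have e2 : ∀ x, c ≤ cubeJoin d (w ⊓ v) (w ⊓ u) (v ⊓ u) x ↔ x 2 = true := by
      refine fun x => ⟨fun h => ?_, fun h => ?_⟩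
      · by_contra hx
        rw [hjm, cubeMeet, eq_false_of_ne_true hx] at h
        exact hnc (h.trans inf_le_right)
      · rw [cubeJoin, h]
        exact hcr.trans le_sup_right
    intro x y hxy
    funext i
    rw [Bool.eq_iff_iff]
    fin_cases i
    · exact (e0 x).symm.trans (hxy ▸ e0 y)
    · exact (e1 x).symm.trans (hxy ▸ e1 y)
    · exact (e2 x).symm.trans (hxy ▸ e2 y)
  have hval : [![false, false, false], ![true, false, false], ![false, true, false],
      ![false, false, true], ![true, true, false], ![false, true, true], ![true, false, true],
      ![true, true, true]].map (cubeJoin d (w ⊓ v) (w ⊓ u) (v ⊓ u)) =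
      [d, w ⊓ v, w ⊓ u, v ⊓ u, w, u, v, t] := by
    simp [cubeJoin, sup_eq_left.2 hdp, hdw, hdq.trans inf_le_right,
      sup_eq_right.2 hdr, hpq, hqr, hprv, hwr]
  refine ⟨hpq, hqr, hrp, ?_, ?_, ?_, hm, ?_, ?_, hpqr, ?_,
    cubeJoin d (w ⊓ v) (w ⊓ u) (v ⊓ u), hinj, cubeJoin_sup hdp hdq hdr, ?_, ?_⟩
  · rw [← inf_inf_distrib_left, ← inf_assoc, hm]
  · rw [← inf_inf_distrib_right, hm]
  · rw [inf_comm w v, ← inf_inf_distrib_left, ← hm]; ac_rfl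
  · rw [inf_right_comm, hm]
  · rw [← hm]; ac_rfl
  · rw [← hval]
    exact List.Nodup.map hinj (by decide)
  · intro x y
    simp only [hjm, cubeMeet_inf hut hvt hwt]
  · rw [range_fin_three_bool]
    simp only [List.map_cons, List.map_nil, List.cons.injEq] at hval
    obtain ⟨k0, k1, k2, k3, k4, k5, k6, k7, -⟩ := hval
    rw [k0, k1, k2, k3, k4, k5, k6, k7]
end

section
/- There is no lattice L with Dec(L) = 2; that is, no lattice admits a distributive partition of minimum cardinality two. -/
/-- A subset of `L` closed under `⊔` and `⊓`. -/
def IsSublatticeSet {L : Type*} [Lattice L] (S : Set L) : Prop :=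
  (∀ x ∈ S, ∀ y ∈ S, x ⊔ y ∈ S) ∧ (∀ x ∈ S, ∀ y ∈ S, x ⊓ y ∈ S)

/-- `S` is an order-convex subset of `L`. -/
def IsConvexSet {L : Type*} [Lattice L] (S : Set L) : Prop :=
  ∀ x ∈ S, ∀ y ∈ S, ∀ z : L, x ≤ z → z ≤ y → z ∈ S

/-- `S` is distributive as a lattice (with the induced operations). -/
def DistribOn {L : Type*} [Lattice L] (S : Set L) : Prop :=
  ∀ x ∈ S, ∀ y ∈ S, ∀ z ∈ S, x ⊓ (y ⊔ z) = (x ⊓ y) ⊔ (x ⊓ z)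

/-- A distributive partition of the lattice `L`. -/
def IsDistribPartition {L : Type*} [Lattice L] (𝓕 : Set (Set L)) : Prop :=
  Setoid.IsPartition 𝓕 ∧
  (∀ F ∈ 𝓕, IsSublatticeSet F ∧ IsConvexSet F ∧ DistribOn F) ∧
  ∀ F₁ ∈ 𝓕, ∀ F₂ ∈ 𝓕, F₁ ≠ F₂ →
    ¬ IsSublatticeSet (F₁ ∪ F₂) ∨ ¬ IsConvexSet (F₁ ∪ F₂) ∨
      (IsSublatticeSet (F₁ ∪ F₂) ∧ IsConvexSet (F₁ ∪ F₂) ∧ DistribOn (F₁ ∪ F₂))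

/-- `Dec L`: the minimum cardinality of a distributive partition of `L`. -/
noncomputable def Dec (L : Type*) [Lattice L] : Cardinal :=
  sInf {c : Cardinal | ∃ 𝓕 : Set (Set L), IsDistribPartition 𝓕 ∧ Cardinal.mk ↥𝓕 = c}

theorem isSublatticeSet_univ {L : Type*} [Lattice L] : IsSublatticeSet (Set.univ : Set L) :=
  ⟨fun _ _ _ _ => Set.mem_univ _, fun _ _ _ _ => Set.mem_univ _⟩

theorem isConvexSet_univ {L : Type*} [Lattice L] : IsConvexSet (Set.univ : Set L) :=
  fun _ _ _ _ _ _ _ => Set.mem_univ _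

/-- The trivial partition of a distributive lattice is a distributive partition. -/
theorem isDistribPartition_singleton_univ {L : Type*} [Lattice L] [Nonempty L]
    (h : DistribOn (Set.univ : Set L)) : IsDistribPartition {(Set.univ : Set L)} := by
  refine ⟨⟨?_, fun a => ⟨Set.univ, by simp, by simp⟩⟩, ?_, ?_⟩
  · simpa using Set.empty_ne_univ
  · rintro F rfl
    exact ⟨isSublatticeSet_univ, isConvexSet_univ, h⟩
  · rintro F₁ rfl F₂ rfl hne
    exact absurd rfl hne

/-- A lattice with a distributive partition into two blocks is distributive. -/
theorem IsDistribPartition.distribOn_univ {L : Type*} [Lattice L] {A B : Set L}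
    (h : IsDistribPartition {A, B}) (hAB : A ≠ B) : DistribOn (Set.univ : Set L) := by
  have hU : A ∪ B = Set.univ := by simpa using h.1.sUnion_eq_univ
  have := h.2.2 A (by simp) B (by simp) hAB
  rw [hU] at this
  rcases this with h | h | h
  · exact absurd isSublatticeSet_univ h
  · exact absurd isConvexSet_univ h
  · exact h.2.2

theorem dec_ne_two {L : Type*} [Lattice L] [Nonempty L] : Dec L ≠ 2 := by
  intro h
  have hne : {c : Cardinal | ∃ 𝓕 : Set (Set L),
      IsDistribPartition 𝓕 ∧ Cardinal.mk ↥𝓕 = c}.Nonempty := by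
    by_contra hempty
    rw [Dec, Set.not_nonempty_iff_eq_empty.mp hempty, Cardinal.sInf_empty] at h
    exact two_ne_zero h.symm
  obtain ⟨𝓕, h𝓕, hcard⟩ := csInf_mem hne
  obtain ⟨A, B, hAB, rfl⟩ : ∃ A B, A ≠ B ∧ 𝓕 = {A, B} := by
    rw [← Set.ncard_eq_two, ← Nat.card_coe_set_eq, Nat.card, hcard.trans h]
    simp
  have hle : Dec L ≤ 1 := csInf_le' ⟨{Set.univ},
    isDistribPartition_singleton_univ (h𝓕.distribOn_univ hAB), Cardinal.mk_singleton _⟩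
  rw [h] at hle
  exact absurd hle (not_le.mpr Cardinal.one_lt_two)
end

section
/- Let L be a lattice and let a, b₁, b₂, b₃, b₄, b₅ ∈ L satisfy a ∥ bᵢ for all 1 ≤ i ≤ 5, bᵢ < bᵢ₊₁ for 1 ≤ i ≤ 4, and a ⊔ bᵢ < a ⊔ bᵢ₊₁ for 1 ≤ i ≤ 4. Then the ten elements a ⊔ bᵢ and (a ⊔ bᵢ) ⊓ b₅ (1 ≤ i ≤ 5) are pairwise distinct, and for all 1 ≤ i < j ≤ 5: (a ⊔ bᵢ) ⊓ b₅ < (a ⊔ bⱼ) ⊓ b₅; a ⊔ bᵢ is incomparable with (a ⊔ bⱼ) ⊓ b₅; (a ⊔ bᵢ) ⊔ ((a ⊔ bⱼ) ⊓ b₅) = a ⊔ bⱼ; and (a ⊔ bᵢ) ⊓ ((a ⊔ bⱼ) ⊓ b₅) = (a ⊔ bᵢ) ⊓ b₅. Consequently these ten elements form a sublattice of L isomorphic to the direct product of a 2-chain and a 5-chain. -/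
theorem two_times_five_sublattice {L : Type*} [Lattice L]
    (a : L) (b : Fin 5 → L)
    (hinc : ∀ i : Fin 5, Incomp a (b i))
    (hchain : ∀ i : Fin 4, b i.castSucc < b i.succ)
    (hjoin : ∀ i : Fin 4, a ⊔ b i.castSucc < a ⊔ b i.succ) :
    (∀ i j : Fin 5, i ≠ j → a ⊔ b i ≠ a ⊔ b j) ∧
    (∀ i j : Fin 5, i ≠ j → (a ⊔ b i) ⊓ b 4 ≠ (a ⊔ b j) ⊓ b 4) ∧
    (∀ i j : Fin 5, a ⊔ b i ≠ (a ⊔ b j) ⊓ b 4) ∧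
    (∀ i j : Fin 5, i < j →
      (a ⊔ b i) ⊓ b 4 < (a ⊔ b j) ⊓ b 4 ∧
      Incomp (a ⊔ b i) ((a ⊔ b j) ⊓ b 4) ∧
      (a ⊔ b i) ⊔ ((a ⊔ b j) ⊓ b 4) = a ⊔ b j ∧
      (a ⊔ b i) ⊓ ((a ⊔ b j) ⊓ b 4) = (a ⊔ b i) ⊓ b 4) ∧
    ∃ f : Bool × Fin 5 → L, Function.Injective f ∧
      (∀ x y : Bool × Fin 5, f (x ⊔ y) = f x ⊔ f y) ∧
      (∀ x y : Bool × Fin 5, f (x ⊓ y) = f x ⊓ f y) ∧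
      Set.range f = {c : L | ∃ i : Fin 5, c = a ⊔ b i ∨ c = (a ⊔ b i) ⊓ b 4} := by
  set c : Fin 5 → L := fun i => a ⊔ b i
  have hb : StrictMono b := Fin.strictMono_iff_lt_succ.2 hchain
  have c_mono : StrictMono c := Fin.strictMono_iff_lt_succ.2 hjoin
  have c_sup : ∀ {i j}, i ≤ j → c i ⊔ (c j ⊓ b 4) = c j := fun {i j} hij =>
    le_antisymm (sup_le (c_mono.monotone hij) inf_le_left)
      (sup_le (le_sup_of_le_left le_sup_left)
        (le_sup_of_le_right (le_inf le_sup_right (hb.monotone (Fin.le_last j)))))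
  have not_d_le : ∀ {i j}, i < j → ¬ c j ⊓ b 4 ≤ c i := fun {i j} hij h =>
    (c_mono hij).not_ge (by rw [← c_sup hij.le]; exact sup_le le_rfl h)
  have not_c_le : ∀ i j, ¬ c i ≤ c j ⊓ b 4 := fun i j h =>
    (hinc 4).1 ((le_sup_left.trans h).trans inf_le_right)
  have d_mono : StrictMono (fun i => c i ⊓ b 4) := fun i j hij =>
    lt_of_le_not_ge (inf_le_inf_right _ (c_mono.monotone hij.le))
      fun h => not_d_le hij (h.trans inf_le_left)
  have c_sup_d : ∀ i j, c i ⊔ (c j ⊓ b 4) = c (i ⊔ j) := fun i j => by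
    rcases le_total i j with h | h
    · rw [c_sup h, sup_eq_right.2 h]
    · rw [sup_eq_left.2 h, sup_eq_left]
      exact inf_le_left.trans (c_mono.monotone h)
  have c_inf_d : ∀ i j, c i ⊓ (c j ⊓ b 4) = c (i ⊓ j) ⊓ b 4 := fun i j => by
    rw [← inf_assoc, c_mono.monotone.map_inf]
  refine ⟨fun i j h => c_mono.injective.ne h, fun i j h => d_mono.injective.ne h,
    fun i j h => not_c_le i j h.le,
    fun i j h => ⟨d_mono h, ⟨not_c_le i j, not_d_le h⟩, c_sup h.le, ?_⟩,
    fun x => if x.1 then c x.2 else c x.2 ⊓ b 4, ?_, ?_, ?_, ?_⟩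
  · exact (c_inf_d i j).trans (by rw [inf_eq_left.2 h.le])
  · rintro ⟨_ | _, i⟩ ⟨_ | _, j⟩ h
    · exact congrArg _ (d_mono.injective h)
    · exact absurd h.ge (not_c_le j i)
    · exact absurd h.le (not_c_le i j)
    · exact congrArg _ (c_mono.injective h)
  · rintro ⟨_ | _, i⟩ ⟨_ | _, j⟩
    · exact d_mono.monotone.map_sup i j
    · exact (((sup_comm _ _).trans (c_sup_d j i)).trans (congrArg c (sup_comm j i))).symm
    · exact (c_sup_d i j).symm
    · exact c_mono.monotone.map_sup i j
  · rintro ⟨_ | _, i⟩ ⟨_ | _, j⟩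
    · exact d_mono.monotone.map_inf i j
    · exact (((inf_comm _ _).trans (c_inf_d j i)).trans
        (congrArg (fun k => c k ⊓ b 4) (inf_comm j i))).symm
    · exact (c_inf_d i j).symm
    · exact c_mono.monotone.map_inf i j
  · ext z
    constructor
    · rintro ⟨⟨_ | _, i⟩, rfl⟩
      · exact ⟨i, Or.inr rfl⟩
      · exact ⟨i, Or.inl rfl⟩
    · rintro ⟨i, rfl | rfl⟩
      · exact ⟨(true, i), rfl⟩
      · exact ⟨(false, i), rfl⟩
end

section
/- Let L be a lattice and let a₁, a₂, a₃, b₁, b₂, b₃ be six distinct elements of L such that a₁ < a₂ < a₃, b₁ < b₂ < b₃, a₁ < b₃, b₁ < a₃, a₂ ∥ bᵢ for i = 1,2,3, aᵢ ∥ b₂ for i = 1,2,3, a₂ ⊔ b₂ = a₃ ⊔ b₃, and a₂ ⊓ b₂ = a₁ ⊓ b₁. Set a₁' = a₂ ⊓ b₃, b₁' = a₃ ⊓ b₂, a₃'' = a₂ ⊔ b₁', and b₃'' = a₁' ⊔ b₂. Then a₁' < a₂ < a₃'', b₁' < b₂ < b₃'', a₁' ∥ b₁', a₃'' ∥ b₃'',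 a₁' ∥ b₂, a₂ ∥ b₁', a₂ ∥ b₃'', a₃'' ∥ b₂, a₁' ⊓ b₁' = a₂ ⊓ b₂, a₃'' ⊔ b₃'' = a₂ ⊔ b₂, a₁' = a₂ ⊓ b₃'', and b₁' = a₃'' ⊓ b₂. -/
theorem L15_lemma_first_step {L : Type*} [Lattice L]
    (a₁ a₂ a₃ b₁ b₂ b₃ : L)
    (hdist : List.Pairwise (· ≠ ·) [a₁, a₂, a₃, b₁, b₂, b₃])
    (ha12 : a₁ < a₂) (ha23 : a₂ < a₃) (hb12 : b₁ < b₂) (hb23 : b₂ < b₃)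
    (hab : a₁ < b₃) (hba : b₁ < a₃)
    (hpar1 : Incomp a₂ b₁) (hpar2 : Incomp a₂ b₂) (hpar3 : Incomp a₂ b₃)
    (hpar4 : Incomp a₁ b₂) (hpar5 : Incomp a₃ b₂)
    (hsup : a₂ ⊔ b₂ = a₃ ⊔ b₃) (hinf : a₂ ⊓ b₂ = a₁ ⊓ b₁) :
    a₂ ⊓ b₃ < a₂ ∧ a₂ < a₂ ⊔ (a₃ ⊓ b₂) ∧
    a₃ ⊓ b₂ < b₂ ∧ b₂ < (a₂ ⊓ b₃) ⊔ b₂ ∧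
    Incomp (a₂ ⊓ b₃) (a₃ ⊓ b₂) ∧
    Incomp (a₂ ⊔ (a₃ ⊓ b₂)) ((a₂ ⊓ b₃) ⊔ b₂) ∧
    Incomp (a₂ ⊓ b₃) b₂ ∧ Incomp a₂ (a₃ ⊓ b₂) ∧
    Incomp a₂ ((a₂ ⊓ b₃) ⊔ b₂) ∧ Incomp (a₂ ⊔ (a₃ ⊓ b₂)) b₂ ∧
    (a₂ ⊓ b₃) ⊓ (a₃ ⊓ b₂) = a₂ ⊓ b₂ ∧
    (a₂ ⊔ (a₃ ⊓ b₂)) ⊔ ((a₂ ⊓ b₃) ⊔ b₂) = a₂ ⊔ b₂ ∧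
    a₂ ⊓ b₃ = a₂ ⊓ ((a₂ ⊓ b₃) ⊔ b₂) ∧
    a₃ ⊓ b₂ = (a₂ ⊔ (a₃ ⊓ b₂)) ⊓ b₂ := by
  have ha₁ : a₁ ≤ a₂ ⊓ b₃ := le_inf ha12.le hab.le
  have hb₁ : b₁ ≤ a₃ ⊓ b₂ := le_inf hba.le hb12.le
  have hA : ¬ a₂ ⊓ b₃ ≤ b₂ := fun h => hpar4.1 (ha₁.trans h)
  have hB : ¬ a₃ ⊓ b₂ ≤ a₂ := fun h => hpar1.2 (hb₁.trans h)
  have hA₃ : a₂ ⊔ (a₃ ⊓ b₂) ≤ a₃ := sup_le ha23.le inf_le_left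
  have hB₃ : (a₂ ⊓ b₃) ⊔ b₂ ≤ b₃ := sup_le inf_le_right hb23.le
  refine ⟨inf_lt_left.2 hpar3.1, left_lt_sup.2 hB, inf_lt_right.2 hpar5.2, right_lt_sup.2 hA,
    ⟨fun h => hA (h.trans inf_le_right), fun h => hB (h.trans inf_le_left)⟩,
    ⟨fun h => hpar3.1 (le_sup_left.trans (h.trans hB₃)),
      fun h => hpar5.2 (le_sup_right.trans (h.trans hA₃))⟩,
    ⟨hA, fun h => hpar2.2 (h.trans inf_le_left)⟩,
    ⟨fun h => hpar2.1 (h.trans inf_le_right), hB⟩,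
    ⟨fun h => hpar3.1 (h.trans hB₃), fun h => hpar2.2 (le_sup_right.trans h)⟩,
    ⟨fun h => hpar2.1 (le_sup_left.trans h), fun h => hpar5.2 (h.trans hA₃)⟩,
    le_antisymm (inf_le_inf inf_le_left inf_le_right)
      (le_inf (inf_le_inf_left _ hb23.le) (inf_le_inf_right _ ha23.le)),
    le_antisymm (sup_le (sup_le_sup_left inf_le_right _) (sup_le_sup_right inf_le_left _))
      (sup_le_sup le_sup_left le_sup_right),
    le_antisymm (le_inf inf_le_left le_sup_left) (inf_le_inf_left _ hB₃),
    le_antisymm (le_inf le_sup_right inf_le_right) (inf_le_inf_right _ hA₃)⟩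
end
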